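/- For the Lasso with scale parameter σ, the penalized residual sum of squares equals the empirical correlation of the response with the residuals: σ̃²(σ) = Yᵀ(Y − Xβ̂(σ))/n. -/

import Mathlib

open Finset Matrix

/-- `‖v‖_n = √(vᵀv/n)`. -/
noncomputable def normN {n : ℕ} (v : Fin n → ℝ) : ℝ :=
  Real.sqrt ((∑ i, v i ^ 2) / n)

/-- `ℓ₁`-norm of a vector. -/
noncomputable def l1norm {p : ℕ} (v : Fin p → ℝ) : ℝ := ∑ j, |v j|

/-- `ℓ_∞`-norm of a vector. -/
noncomputable def lsup {p : ℕ} (v : Fin p → ℝ) : ℝ := ⨆ j, |v j|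

/-- `β_S`: the vector `β` with entries outside `S` set to zero. -/
def sub0 {p : ℕ} (S : Finset (Fin p)) (β : Fin p → ℝ) : Fin p → ℝ :=
  fun j => if j ∈ S then β j else 0

/-- The compatibility constant squared `φ̂²(L,S)`. -/
noncomputable def compatSq {n p : ℕ} (X : Matrix (Fin n) (Fin p) ℝ) (L : ℝ)
    (S : Finset (Fin p)) : ℝ :=
  sInf { r | ∃ β : Fin p → ℝ, l1norm (sub0 S β) = 1 ∧ l1norm (sub0 Sᶜ β) ≤ L ∧
    r = S.card * (normN (X.mulVec (sub0 S β) - X.mulVec (sub0 Sᶜ β))) ^ 2 }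

theorem normN_sq {n : ℕ} (v : Fin n → ℝ) : normN v ^ 2 = v ⬝ᵥ v / n := by
  rw [normN, Real.sq_sqrt (by positivity)]
  simp only [dotProduct, sq]

theorem normN_sub_smul_sq {n : ℕ} (r v : Fin n → ℝ) (t : ℝ) :
    normN (r - t • v) ^ 2 = normN r ^ 2 - 2 * t * (v ⬝ᵥ r / n) + t ^ 2 * normN v ^ 2 := by
  simp only [normN_sq, sub_dotProduct, dotProduct_sub, smul_dotProduct, dotProduct_smul,
    smul_eq_mul, dotProduct_comm r v]
  ring

theorem l1norm_smul {p : ℕ} (c : ℝ) (v : Fin p → ℝ) : l1norm (c • v) = |c| * l1norm v := by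
  simp only [l1norm, Pi.smul_apply, smul_eq_mul, abs_mul, mul_sum]

theorem eq_zero_of_quadratic_nonneg_near_zero {a d : ℝ} (hd : 0 ≤ d)
    (h : ∀ t : ℝ, |t| ≤ 1 → 0 ≤ 2 * t * a + t ^ 2 * d) : a = 0 := by
  have hm : 0 < d + |a| + 1 := by positivity
  have ht := h (-a / (d + |a| + 1)) (by
    rw [abs_div, abs_neg, abs_of_pos hm, div_le_one hm]
    linarith)
  have hquad : 2 * (-a / (d + |a| + 1)) * a + (-a / (d + |a| + 1)) ^ 2 * d =
      -(a ^ 2 * (d + 2 * |a| + 2)) / (d + |a| + 1) ^ 2 := by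
    field_simp
    ring
  rw [hquad, le_div_iff₀ (by positivity), zero_mul] at ht
  have := abs_nonneg a
  have hsq : a ^ 2 ≤ 0 := by nlinarith [sq_nonneg a, mul_nonneg (sq_nonneg a) this]
  exact pow_eq_zero_iff two_ne_zero |>.mp (le_antisymm hsq (sq_nonneg a))

theorem scaled_lasso_normal_equations
    {n p : ℕ} (X : Matrix (Fin n) (Fin p) ℝ) (Y : Fin n → ℝ)
    (lam σ : ℝ) (hlam : 0 < lam) (hσ : 0 < σ)
    (βhat : Fin p → ℝ)
    (hβhat : ∀ β : Fin p → ℝ,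
      (normN (Y - X.mulVec βhat)) ^ 2 + 2 * lam * σ * l1norm βhat ≤
        (normN (Y - X.mulVec β)) ^ 2 + 2 * lam * σ * l1norm β) :
    (normN (Y - X.mulVec βhat)) ^ 2 + lam * σ * l1norm βhat =
      Y ⬝ᵥ (Y - X.mulVec βhat) / n := by
  have hstat : lam * σ * l1norm βhat - X.mulVec βhat ⬝ᵥ (Y - X.mulVec βhat) / n = 0 := by
    refine eq_zero_of_quadratic_nonneg_near_zero (sq_nonneg (normN (X.mulVec βhat))) fun t ht => ?_
    have hmin := hβhat ((1 + t) • βhat)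
    have hres : Y - X.mulVec ((1 + t) • βhat) = (Y - X.mulVec βhat) - t • X.mulVec βhat := by
      rw [mulVec_smul, add_smul, one_smul]
      abel
    rw [hres, normN_sub_smul_sq, l1norm_smul,
      abs_of_nonneg (by linarith [(abs_le.mp ht).1])] at hmin
    linarith
  have hsplit : normN (Y - X.mulVec βhat) ^ 2 =
      Y ⬝ᵥ (Y - X.mulVec βhat) / n - X.mulVec βhat ⬝ᵥ (Y - X.mulVec βhat) / n := by
    rw [normN_sq, ← sub_div, ← sub_dotProduct]
  linarith
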